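/- Let N ≥ 2 and let q ∈ ℂ be a primitive 4N-th root of unity with q^N = i. Then: (i) q_{(N−m)} = q_{(m)} for all integers 0 ≤ m ≤ N; and (ii) for every strict partition of the form (N, λ₂, …, λ_r) (so N > λ₂ > … > λ_r > 0) one has q_{(N, λ₂, …, λ_r)} = q_{(λ₂, …, λ_r)}. -/

import Mathlib

noncomputable section

/-- The quantum integer `[k] = (q^k - q^{-k})/(q - q⁻¹)`. -/
def qnum (q : ℂ) (k : ℤ) : ℂ := (q ^ k - q ^ (-k)) / (q - q⁻¹)

/-- The one-row quantity `q_{(m)} = ∏_{j=1}^m i (q^{j-1} + q^{1-j})/(q^j - q^{-j})`. -/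
def qrow (q : ℂ) (m : ℕ) : ℂ :=
  ∏ j ∈ Finset.Icc 1 m,
    Complex.I * (q ^ ((j : ℤ) - 1) + q ^ (1 - (j : ℤ))) / (q ^ (j : ℤ) - q ^ (-(j : ℤ)))

/-- The quantity `q_λ` attached to a strict partition `λ = (λ₁ > … > λ_r > 0)`
(given as a function `Fin r → ℕ`):
`q_λ = ∏_j q_{(λ_j)} ∏_{i<j} [λ_i - λ_j]/[λ_i + λ_j]`. -/
def qpart (q : ℂ) {r : ℕ} (lam : Fin r → ℕ) : ℂ :=
  (∏ j, qrow q (lam j)) *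
    ∏ p ∈ Finset.univ.filter (fun p : Fin r × Fin r => p.1 < p.2),
      qnum q ((lam p.1 : ℤ) - (lam p.2 : ℤ)) / qnum q ((lam p.1 : ℤ) + (lam p.2 : ℤ))

end

/-- If `q ^ N = i`, then `q ^ k - q ^ (-k) = i (q ^ (N - k) + q ^ (k - N))`. -/
theorem zpow_sub_zpow_neg_eq {N : ℕ} {q : ℂ} (hq0 : q ≠ 0) (hqN : q ^ N = Complex.I) (k : ℤ) :
    q ^ k - q ^ (-k) = Complex.I * (q ^ ((N : ℤ) - k) + q ^ (k - (N : ℤ))) := by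
  rw [zpow_sub₀ hq0, zpow_sub₀ hq0, zpow_natCast, hqN, zpow_neg]
  field_simp [Complex.I_ne_zero]
  rw [Complex.I_sq]
  ring

theorem zpow_add_zpow_neg_ne_zero {N : ℕ} {q : ℂ} (hq : IsPrimitiveRoot q (4 * N))
    (hqN : q ^ N = Complex.I) {k : ℕ} (hk : k < N) :
    q ^ (k : ℤ) + q ^ (-(k : ℤ)) ≠ 0 := by
  have hq0 : q ≠ 0 := hq.ne_zero (by omega)
  intro h
  rw [zpow_neg, zpow_natCast] at h
  field_simp at h
  have h2 : q ^ (2 * k) = q ^ (2 * N) := by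
    rw [mul_comm 2 N, pow_mul q N, hqN, Complex.I_sq, mul_comm 2 k, pow_mul]
    linear_combination h
  have := hq.pow_inj (by omega) (by omega) h2
  omega

theorem zpow_sub_zpow_neg_ne_zero {N : ℕ} {q : ℂ} (hq : IsPrimitiveRoot q (4 * N))
    (hqN : q ^ N = Complex.I) {k : ℕ} (hk0 : 0 < k) (hk : k ≤ N) :
    q ^ (k : ℤ) - q ^ (-(k : ℤ)) ≠ 0 := by
  rw [zpow_sub_zpow_neg_eq (hq.ne_zero (by omega)) hqN]
  have h := zpow_add_zpow_neg_ne_zero hq hqN (k := N - k) (by omega)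
  rw [Nat.cast_sub hk, neg_sub] at h
  exact mul_ne_zero Complex.I_ne_zero h

/-- One more factor of `qrow`, with numerator and denominator in the same form. -/
theorem qrow_succ {N : ℕ} {q : ℂ} (hq0 : q ≠ 0) (hqN : q ^ N = Complex.I) {m d : ℕ}
    (h : m + 1 + d = N) :
    qrow q (m + 1) = qrow q m *
      ((q ^ (m : ℤ) + q ^ (-(m : ℤ))) / (q ^ (d : ℤ) + q ^ (-(d : ℤ)))) := by
  have hd : (N : ℤ) - ((m + 1 : ℕ) : ℤ) = d := by omega
  have hd' : ((m + 1 : ℕ) : ℤ) - (N : ℤ) = -d := by omega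
  have hm : ((m + 1 : ℕ) : ℤ) - 1 = m := by omega
  have hm' : 1 - ((m + 1 : ℕ) : ℤ) = -m := by omega
  rw [qrow, Finset.prod_Icc_succ_top (by omega), ← qrow, zpow_sub_zpow_neg_eq hq0 hqN, hd, hd',
    hm, hm', mul_div_mul_left _ _ Complex.I_ne_zero]

theorem qrow_eq_of_add_eq {N : ℕ} {q : ℂ} (hq : IsPrimitiveRoot q (4 * N))
    (hqN : q ^ N = Complex.I) (hN : 0 < N) (d m : ℕ) (h : 2 * m + d = N) :
    qrow q (m + d) = qrow q m := by
  have hq0 : q ≠ 0 := hq.ne_zero (by omega)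
  induction d using Nat.twoStepInduction generalizing m with
  | zero => rfl
  | one =>
    rw [qrow_succ hq0 hqN (d := m) (by omega),
      div_self (zpow_add_zpow_neg_ne_zero hq hqN (by omega)), mul_one]
  | more d ih _ =>
    have h₁ := zpow_add_zpow_neg_ne_zero hq hqN (k := m) (by omega)
    have h₂ := zpow_add_zpow_neg_ne_zero hq hqN (k := m + d + 1) (by omega)
    have h₃ := ih (m + 1) (by omega)
    rw [show m + 1 + d = m + d + 1 by omega,
      qrow_succ (m := m) (d := m + d + 1) hq0 hqN (by omega)] at h₃
    rw [show m + (d + 2) = m + d + 1 + 1 by omega,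
      qrow_succ (m := m + d + 1) (d := m) hq0 hqN (by omega), h₃, mul_assoc, div_mul_div_cancel₀ h₂,
      div_self h₁, mul_one]

theorem qrow_sub {N : ℕ} {q : ℂ} (hq : IsPrimitiveRoot q (4 * N)) (hqN : q ^ N = Complex.I)
    (hN : 0 < N) {m : ℕ} (hm : m ≤ N) : qrow q (N - m) = qrow q m := by
  rcases le_total (2 * m) N with h | h
  · have := qrow_eq_of_add_eq hq hqN hN (N - 2 * m) m (by omega)
    rwa [show m + (N - 2 * m) = N - m by omega] at this
  · have := qrow_eq_of_add_eq hq hqN hN (2 * m - N) (N - m) (by omega)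
    rw [show N - m + (2 * m - N) = m by omega] at this
    exact this.symm

theorem qnum_sub_div_qnum_add {N : ℕ} {q : ℂ} (hq : IsPrimitiveRoot q (4 * N))
    (hqN : q ^ N = Complex.I) {k : ℕ} (hk : k < N) :
    qnum q ((N : ℤ) - k) / qnum q ((N : ℤ) + k) = 1 := by
  have hq0 : q ≠ 0 := hq.ne_zero (by omega)
  have h₁ : q - q⁻¹ ≠ 0 := by
    simpa using zpow_sub_zpow_neg_ne_zero hq hqN one_pos (by omega)
  have h₂ : qnum q ((N : ℤ) - k) = qnum q ((N : ℤ) + k) := by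
    rw [qnum, qnum, zpow_sub_zpow_neg_eq hq0 hqN, zpow_sub_zpow_neg_eq hq0 hqN]
    ring_nf
  rw [h₂, div_self]
  rw [qnum, zpow_sub_zpow_neg_eq hq0 hqN]
  have h₃ := zpow_add_zpow_neg_ne_zero hq hqN hk
  refine div_ne_zero (mul_ne_zero Complex.I_ne_zero ?_) h₁
  rw [sub_add_cancel_left, add_sub_cancel_left, add_comm]
  exact h₃

theorem qpart_succ (q : ℂ) {r : ℕ} (lam : Fin (r + 1) → ℕ) :
    qpart q lam = qrow q (lam 0) *
      (∏ j : Fin r, qnum q ((lam 0 : ℤ) - lam j.succ) / qnum q ((lam 0 : ℤ) + lam j.succ)) *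
      qpart q (fun i : Fin r => lam i.succ) := by
  simp only [qpart, Finset.prod_filter, Fintype.prod_prod_type, Fin.prod_univ_succ,
    Fin.succ_lt_succ_iff, Fin.succ_pos, Fin.not_lt_zero, if_true, if_false, one_mul]
  ring

/-- let `q` be a primitive `4N`-th root of unity with `q^N = i`. Then
(i) `q_{(N-m)} = q_{(m)}` for `0 ≤ m ≤ N`, and (ii) for every strict partition of the
form `(N, λ₂, …, λ_r)` one has `q_{(N,λ₂,…,λ_r)} = q_{(λ₂,…,λ_r)}`. -/
theorem qrow_qpart_symmetry (N : ℕ) (hN : 2 ≤ N) (q : ℂ)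
    (hq : IsPrimitiveRoot q (4 * N)) (hqN : q ^ N = Complex.I) :
    (∀ m : ℕ, m ≤ N → qrow q (N - m) = qrow q m) ∧
    (∀ (r : ℕ) (lam : Fin (r + 1) → ℕ),
      (∀ i j : Fin (r + 1), i < j → lam j < lam i) → (∀ i, 0 < lam i) →
      lam 0 = N →
      qpart q lam = qpart q (fun i : Fin r => lam i.succ)) := by
  refine ⟨fun m hm => qrow_sub hq hqN (by omega) hm, fun r lam hlam _ h0 => ?_⟩
  have hrow : qrow q N = 1 := by
    have := qrow_sub hq hqN (by omega) (Nat.zero_le N)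
    simpa [qrow] using this
  rw [qpart_succ, h0, hrow, Finset.prod_eq_one, one_mul, one_mul]
  intro j _
  exact qnum_sub_div_qnum_add hq hqN (h0 ▸ hlam 0 j.succ j.succ_pos)
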